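/- arXiv:1804.04693 — 3 statements merged into one kernel-verified Lean document; each statement's English description precedes it below -/
import Mathlib

section
/- The maximum Kronecker coefficient K(n) = max_{λ,μ,ν⊢n} g(λ,μ,ν) satisfies √(n!)/p(n)^{3/2} ≤ K(n) ≤ D(n), where D(n) = max_{λ⊢n} f^λ and p(n) is the number of partitions of n. -/
open CategoryTheory

/-- The symmetric group `Sₙ`, realized as permutations of `Fin n`. -/
abbrev SymGrp (n : ℕ) : Type := Equiv.Perm (Fin n)

/-- The dimension of a representation. -/
noncomputable def dimRep {n : ℕ} (V : FDRep ℂ (SymGrp n)) : ℕ := Module.finrank ℂ V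

/-- `V` is a complete family of pairwise non-isomorphic irreducible (complex)
representations of the symmetric group `Sₙ`, indexed by the partitions of `n`. -/
def IsIrrFamily {n : ℕ} (V : Nat.Partition n → FDRep ℂ (SymGrp n)) : Prop :=
  (∀ l, Simple (V l)) ∧
  (∀ l m : Nat.Partition n, Nonempty (V l ≅ V m) → l = m) ∧
  (∀ W : FDRep ℂ (SymGrp n), Simple W → ∃ l, Nonempty (W ≅ V l))

/-- The Kronecker coefficient `g(λ,μ,ν)`: the multiplicity of the irreducible `V λ` in
the (internal) tensor product `V μ ⊗ V ν`, computed as `dim Hom(V μ ⊗ V ν, V λ)`. -/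
noncomputable def kron {n : ℕ} (V : Nat.Partition n → FDRep ℂ (SymGrp n))
    (l m v : Nat.Partition n) : ℕ :=
  Module.finrank ℂ ((MonoidalCategoryStruct.tensorObj (V m) (V v)) ⟶ V l)

/-- The largest Kronecker coefficient `K(n) = max_{λ,μ,ν ⊢ n} g(λ,μ,ν)`. -/
noncomputable def maxKron {n : ℕ} (V : Nat.Partition n → FDRep ℂ (SymGrp n)) : ℕ :=
  Finset.univ.sup
    (fun t : Nat.Partition n × Nat.Partition n × Nat.Partition n => kron V t.1 t.2.1 t.2.2)

/-- The largest dimension `D(n) = max_{λ ⊢ n} f^λ` of an irreducible representation. -/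
noncomputable def maxDim {n : ℕ} (V : Nat.Partition n → FDRep ℂ (SymGrp n)) : ℕ :=
  Finset.univ.sup (fun l : Nat.Partition n => dimRep (V l))

/-- The number of partitions `p(n)`. -/
def numPart (n : ℕ) : ℕ := Fintype.card (Nat.Partition n)

theorem SymGrp.isConj_inv {n : ℕ} (g : SymGrp n) : IsConj g g⁻¹ := by
  rw [Equiv.Perm.isConj_iff_cycleType_eq, Equiv.Perm.cycleType_inv]

theorem SymGrp.card_conjClasses_le (n : ℕ) [Fintype (ConjClasses (SymGrp n))] :
    Fintype.card (ConjClasses (SymGrp n)) ≤ Fintype.card (Nat.Partition n) := by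
  have hcard : Fintype.card (Nat.Partition n) =
      Fintype.card (Nat.Partition (Fintype.card (Fin n))) := by
    rw [Fintype.card_fin]
  rw [hcard]
  refine Fintype.card_le_of_injective
    (Quotient.lift (fun g : SymGrp n => g.partition)
      fun _ _ h => Equiv.Perm.partition_eq_of_isConj.1 h) ?_
  rintro ⟨g⟩ ⟨h⟩ hgh
  exact Quotient.sound (Equiv.Perm.partition_eq_of_isConj.2 hgh)

theorem FDRep.character_eq_of_isConj {G : Type*} [Group G] {k : Type*} [Field k]
    (W : FDRep k G) {g h : G} (hgh : IsConj g h) : W.character g = W.character h := by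
  obtain ⟨c, rfl⟩ := isConj_iff.1 hgh
  exact (W.char_conj g c).symm

theorem SymGrp.character_inv {n : ℕ} (W : FDRep ℂ (SymGrp n)) (g : SymGrp n) :
    W.character g⁻¹ = W.character g :=
  (W.character_eq_of_isConj (SymGrp.isConj_inv g)).symm

section

variable {n : ℕ} {V : Nat.Partition n → FDRep ℂ (SymGrp n)}

theorem IsIrrFamily.sum_character_mul (hV : IsIrrFamily V) (l m : Nat.Partition n) :
    ∑ g, (V l).character g * (V m).character g = if l = m then (n.factorial : ℂ) else 0 := by
  have := hV.1 l
  have := hV.1 m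
  have hG : (Nat.card (SymGrp n) : ℂ) ≠ 0 := by exact_mod_cast Nat.card_pos.ne'
  have : Invertible (Nat.card (SymGrp n) : ℂ) := invertibleOfNonzero hG
  have h := FDRep.char_orthonormal (V l) (V m)
  simp only [SymGrp.character_inv] at h
  rw [inv_mul_eq_iff_eq_mul₀ hG] at h
  have hiff : Nonempty (V l ≅ V m) ↔ l = m :=
    ⟨hV.2.1 l m, fun e => e ▸ ⟨Iso.refl _⟩⟩
  rw [h]
  simp [hiff, Nat.card_eq_fintype_card, Fintype.card_perm]

/-- The irreducible characters span the class functions. -/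
theorem IsIrrFamily.exists_eq_sum_character (hV : IsIrrFamily V) (F : SymGrp n → ℂ)
    (hF : ∀ g h, IsConj g h → F g = F h) :
    ∃ c : Nat.Partition n → ℂ, ∀ g, F g = ∑ l, c l * (V l).character g := by
  classical
  have : Fintype (ConjClasses (SymGrp n)) := Fintype.ofFinite _
  let ψ : Nat.Partition n → ConjClasses (SymGrp n) → ℂ := fun l =>
    Quotient.lift (V l).character fun _ _ h => (V l).character_eq_of_isConj h
  have hψ : ∀ (c : Nat.Partition n → ℂ) g,
      (∑ l, c l • ψ l) (ConjClasses.mk g) = ∑ l, c l * (V l).character g := fun c g => by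
    rw [Finset.sum_apply]
    rfl
  have hli : LinearIndependent ℂ ψ := by
    rw [Fintype.linearIndependent_iff]
    intro c hc m
    have h : ∀ g, ∑ l, c l * (V l).character g = 0 := fun g => by
      rw [← hψ, hc, Pi.zero_apply]
    have h' : ∑ g, (∑ l, c l * (V l).character g) * (V m).character g = 0 := by simp [h]
    simp_rw [Finset.sum_mul, mul_assoc] at h'
    rw [Finset.sum_comm] at h'
    simp_rw [← Finset.mul_sum, hV.sum_character_mul] at h'
    simpa [Nat.factorial_ne_zero] using h'
  have hcard : Fintype.card (Nat.Partition n) =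
      Module.finrank ℂ (ConjClasses (SymGrp n) → ℂ) := by
    refine le_antisymm hli.fintype_card_le_finrank ?_
    rw [Module.finrank_fintype_fun_eq_card]
    exact SymGrp.card_conjClasses_le n
  have hspan := hli.span_eq_top_of_card_eq_finrank' hcard
  let F' : ConjClasses (SymGrp n) → ℂ := Quotient.lift F hF
  have hmem : F' ∈ Submodule.span ℂ (Set.range ψ) := hspan ▸ Submodule.mem_top
  obtain ⟨c, hc⟩ := (Submodule.mem_span_range_iff_exists_fun ℂ).1 hmem
  refine ⟨c, fun g => ?_⟩
  rw [← hψ, hc]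
  rfl

theorem IsIrrFamily.factorial_mul_eq_sum (hV : IsIrrFamily V) (F : SymGrp n → ℂ)
    (hF : ∀ g h, IsConj g h → F g = F h) (x : SymGrp n) :
    n.factorial * F x = ∑ l, (∑ g, F g * (V l).character g) * (V l).character x := by
  obtain ⟨c, hc⟩ := hV.exists_eq_sum_character F hF
  have h : ∀ m, ∑ g, F g * (V m).character g = c m * n.factorial := fun m => by
    simp_rw [hc, Finset.sum_mul, mul_assoc]
    rw [Finset.sum_comm]
    simp_rw [← Finset.mul_sum, hV.sum_character_mul]
    simp
  simp_rw [h, hc x, Finset.mul_sum]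
  exact Finset.sum_congr rfl fun l _ => by ring

theorem IsIrrFamily.sum_dimRep_sq (hV : IsIrrFamily V) :
    ∑ l, dimRep (V l) ^ 2 = n.factorial := by
  have h := hV.factorial_mul_eq_sum (fun g => if g = 1 then 1 else 0) (fun g h hgh => by
    obtain ⟨c, rfl⟩ := isConj_iff.1 hgh
    simp) 1
  simp only [ite_mul, one_mul, zero_mul, Finset.sum_ite_eq', Finset.mem_univ, if_true,
    FDRep.char_one, mul_one] at h
  simp only [dimRep, sq]
  exact_mod_cast h.symm

theorem factorial_mul_kron (V : Nat.Partition n → FDRep ℂ (SymGrp n)) (l m v : Nat.Partition n) :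
    (n.factorial : ℂ) * kron V l m v =
      ∑ g, (V m).character g * (V v).character g * (V l).character g := by
  have hG : (Nat.card (SymGrp n) : ℂ) ≠ 0 := by exact_mod_cast Nat.card_pos.ne'
  have : Invertible (Nat.card (SymGrp n) : ℂ) := invertibleOfNonzero hG
  have h := FDRep.scalar_product_char_eq_finrank_equivariant
    (MonoidalCategoryStruct.tensorObj (V m) (V v)) (V l)
  rw [inv_mul_eq_iff_eq_mul₀ hG, Nat.card_eq_fintype_card, Fintype.card_perm,
    Fintype.card_fin] at h
  rw [kron, ← h]
  refine Finset.sum_congr rfl fun g _ => ?_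
  rw [SymGrp.character_inv, FDRep.char_tensor, Pi.mul_apply, mul_comm]

theorem kron_swap (V : Nat.Partition n → FDRep ℂ (SymGrp n)) (l m v : Nat.Partition n) :
    kron V l m v = kron V m l v := by
  have hn : (n.factorial : ℂ) ≠ 0 := by exact_mod_cast n.factorial_ne_zero
  have h : (n.factorial : ℂ) * kron V l m v = n.factorial * kron V m l v := by
    rw [factorial_mul_kron, factorial_mul_kron]
    exact Finset.sum_congr rfl fun g _ => by ring
  exact_mod_cast mul_left_cancel₀ hn h

theorem IsIrrFamily.sum_kron_mul_dimRep (hV : IsIrrFamily V) (m v : Nat.Partition n) :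
    ∑ l, kron V l m v * dimRep (V l) = dimRep (V m) * dimRep (V v) := by
  have hn : (n.factorial : ℂ) ≠ 0 := by exact_mod_cast n.factorial_ne_zero
  have h := hV.factorial_mul_eq_sum (fun g => (V m).character g * (V v).character g)
    (fun g h hgh => by
      rw [(V m).character_eq_of_isConj hgh, (V v).character_eq_of_isConj hgh]) 1
  simp_rw [← factorial_mul_kron, mul_assoc, ← Finset.mul_sum, FDRep.char_one] at h
  simp only [dimRep]
  exact_mod_cast (mul_left_cancel₀ hn h).symm

theorem IsIrrFamily.dimRep_pos (hV : IsIrrFamily V) (l : Nat.Partition n) :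
    0 < dimRep (V l) := by
  rw [Nat.pos_iff_ne_zero]
  intro h0
  have : Subsingleton (V l) := Module.finrank_zero_iff.1 h0
  have h := hV.sum_character_mul l l
  have hχ : ∀ g, (V l).character g = 0 := fun g => by
    rw [FDRep.character, Subsingleton.elim ((V l).ρ g) 0, map_zero]
  simp [hχ, eq_comm, Nat.factorial_ne_zero] at h

theorem IsIrrFamily.kron_le_dimRep (hV : IsIrrFamily V) (l m v : Nat.Partition n) :
    kron V l m v ≤ dimRep (V v) := by
  have key : ∀ a b, kron V a b v * dimRep (V a) ≤ dimRep (V b) * dimRep (V v) := fun a b =>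
    (hV.sum_kron_mul_dimRep b v) ▸
      Finset.single_le_sum (f := fun a => kron V a b v * dimRep (V a))
        (fun _ _ => Nat.zero_le _) (Finset.mem_univ a)
  wlog hlm : dimRep (V m) ≤ dimRep (V l) generalizing l m
  · rw [kron_swap]
    exact this m l (le_of_not_ge hlm)
  refine Nat.le_of_mul_le_mul_right ?_ (hV.dimRep_pos l)
  calc kron V l m v * dimRep (V l) ≤ dimRep (V m) * dimRep (V v) := key l m
    _ ≤ dimRep (V l) * dimRep (V v) := Nat.mul_le_mul_right _ hlm
    _ = dimRep (V v) * dimRep (V l) := mul_comm _ _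

theorem kron_le_maxKron (V : Nat.Partition n → FDRep ℂ (SymGrp n)) (l m v : Nat.Partition n) :
    kron V l m v ≤ maxKron V :=
  Finset.le_sup (f := fun t : Nat.Partition n × Nat.Partition n × Nat.Partition n =>
    kron V t.1 t.2.1 t.2.2) (Finset.mem_univ (l, m, v))

theorem IsIrrFamily.factorial_le (hV : IsIrrFamily V) :
    n.factorial ≤ numPart n ^ 3 * maxKron V ^ 2 := by
  have hcs : ∀ m v, (dimRep (V m) * dimRep (V v)) ^ 2 ≤
      (numPart n * maxKron V ^ 2) * n.factorial := fun m v => by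
    rw [← hV.sum_kron_mul_dimRep m v, ← hV.sum_dimRep_sq]
    refine (Finset.sum_mul_sq_le_sq_mul_sq _ _ _).trans (Nat.mul_le_mul_right _ ?_)
    calc ∑ l, kron V l m v ^ 2 ≤ ∑ _l : Nat.Partition n, maxKron V ^ 2 :=
          Finset.sum_le_sum fun l _ => Nat.pow_le_pow_left (kron_le_maxKron V l m v) 2
      _ = numPart n * maxKron V ^ 2 := by simp [numPart]
  refine Nat.le_of_mul_le_mul_right ?_ n.factorial_pos
  calc n.factorial * n.factorial
      = ∑ m, ∑ v, (dimRep (V m) * dimRep (V v)) ^ 2 := by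
        simp_rw [mul_pow, ← Finset.mul_sum, ← Finset.sum_mul, hV.sum_dimRep_sq]
    _ ≤ ∑ _m : Nat.Partition n, ∑ _v : Nat.Partition n,
          (numPart n * maxKron V ^ 2) * n.factorial :=
        Finset.sum_le_sum fun m _ => Finset.sum_le_sum fun v _ => hcs m v
    _ = numPart n ^ 3 * maxKron V ^ 2 * n.factorial := by
        simp only [Finset.sum_const, Finset.card_univ, smul_eq_mul, numPart]
        ring

end

/-- `√(n!)/p(n)^{3/2} ≤ K(n) ≤ D(n)`. -/
theorem stmt3 (n : ℕ) (V : Nat.Partition n → FDRep ℂ (SymGrp n)) (hV : IsIrrFamily V) :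
    Real.sqrt (Nat.factorial n) / (numPart n : ℝ) ^ ((3 : ℝ) / 2) ≤ (maxKron V : ℝ) ∧
    maxKron V ≤ maxDim V := by
  constructor
  · have hp : (0 : ℝ) < numPart n := by exact_mod_cast (Fintype.card_pos : 0 < numPart n)
    rw [div_le_iff₀ (Real.rpow_pos_of_pos hp _)]
    refine Real.sqrt_le_iff.2 ⟨by positivity, ?_⟩
    have hpow : ((numPart n : ℝ) ^ ((3 : ℝ) / 2)) ^ 2 = (numPart n : ℝ) ^ 3 := by
      rw [← Real.rpow_natCast, ← Real.rpow_mul hp.le, ← Real.rpow_natCast]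
      norm_num
    rw [mul_pow, hpow, mul_comm]
    exact_mod_cast hV.factorial_le
  · refine Finset.sup_le fun t _ => (hV.kron_le_dimRep _ _ _).trans ?_
    exact Finset.le_sup (f := fun l => dimRep (V l)) (Finset.mem_univ t.2.2)
end

section
/- For all n, the maximum Kronecker coefficient satisfies K(n) ≥ D(n)²/√(p(n)·n!), where D(n) is the largest dimension of an irreducible representation of S_n and p(n) is the partition function. -/
open CategoryTheory

open Limits

theorem finrank_eq_add_of_splitting {M N P : Type*} [AddCommGroup M] [AddCommGroup N]
    [AddCommGroup P] [Module ℂ M] [Module ℂ N] [Module ℂ P] [FiniteDimensional ℂ M]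
    [FiniteDimensional ℂ N] (i : M →ₗ[ℂ] P) (r : P →ₗ[ℂ] M) (j : N →ₗ[ℂ] P) (s : P →ₗ[ℂ] N)
    (hir : ∀ x, r (i x) = x) (hjs : ∀ x, s (j x) = x) (hjr : ∀ x, r (j x) = 0)
    (his : ∀ x, s (i x) = 0) (hsum : ∀ x, i (r x) + j (s x) = x) :
    Module.finrank ℂ P = Module.finrank ℂ M + Module.finrank ℂ N := by
  rw [← Module.finrank_prod]
  refine LinearEquiv.finrank_eq (LinearEquiv.ofLinearMap (r.prod s) (i.coprod j) ?_ ?_)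
  · ext x <;> simp [hir, hjs, hjr, his]
  · ext x; simp [hsum]

namespace FDRep

/-- The linear map underlying a morphism of representations. -/
noncomputable def homToLinearMap {G : Type} [Group G] {A B : FDRep ℂ G} (f : A ⟶ B) :
    A →ₗ[ℂ] B := f.hom.hom.hom

variable {G : Type} [Group G] {A B W : FDRep ℂ G}

theorem homToLinearMap_injective :
    Function.Injective (homToLinearMap : (A ⟶ B) → (A →ₗ[ℂ] B)) := by
  intro f g h
  apply Action.Hom.ext
  ext x
  exact LinearMap.congr_fun h x

theorem finrank_eq_add_of_splitting (i : A ⟶ W) (r : W ⟶ A) (j : B ⟶ W) (s : W ⟶ B)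
    (hir : i ≫ r = 𝟙 A) (hjs : j ≫ s = 𝟙 B) (hjr : j ≫ r = 0)
    (his : i ≫ s = 0) (hsum : r ≫ i + s ≫ j = 𝟙 W) :
    Module.finrank ℂ W = Module.finrank ℂ A + Module.finrank ℂ B := by
  refine _root_.finrank_eq_add_of_splitting (homToLinearMap i) (homToLinearMap r)
    (homToLinearMap j) (homToLinearMap s)
    (fun x => ?_) (fun x => ?_) (fun x => ?_) (fun x => ?_) (fun x => ?_)
  · exact LinearMap.congr_fun (congrArg homToLinearMap hir) x
  · exact LinearMap.congr_fun (congrArg homToLinearMap hjs) x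
  · exact LinearMap.congr_fun (congrArg homToLinearMap hjr) x
  · exact LinearMap.congr_fun (congrArg homToLinearMap his) x
  · exact LinearMap.congr_fun (congrArg homToLinearMap hsum) x

theorem finrank_hom_eq_add_of_splitting (i : A ⟶ W) (r : W ⟶ A) (j : B ⟶ W) (s : W ⟶ B)
    (hir : i ≫ r = 𝟙 A) (hjs : j ≫ s = 𝟙 B) (hjr : j ≫ r = 0)
    (his : i ≫ s = 0) (hsum : r ≫ i + s ≫ j = 𝟙 W) (X : FDRep ℂ G) :
    Module.finrank ℂ (W ⟶ X) = Module.finrank ℂ (A ⟶ X) + Module.finrank ℂ (B ⟶ X) := by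
  refine _root_.finrank_eq_add_of_splitting (Linear.leftComp ℂ X r) (Linear.leftComp ℂ X i)
    (Linear.leftComp ℂ X s) (Linear.leftComp ℂ X j)
    (fun x => ?_) (fun x => ?_) (fun x => ?_) (fun x => ?_) (fun x => ?_)
  · simp [← Category.assoc, hir]
  · simp [← Category.assoc, hjs]
  · simp [← Category.assoc, his]
  · simp [← Category.assoc, hjr]
  · simp [← Category.assoc, ← Preadditive.add_comp, hsum]

theorem hom_eq_zero_of_finrank_eq_zero (h : Module.finrank ℂ A = 0) (f : A ⟶ B) : f = 0 := by
  apply homToLinearMap_injective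
  have := Module.finrank_zero_iff.mp h
  exact Subsingleton.elim _ _

theorem finrank_eq_zero_of_id_eq_zero (h : 𝟙 A = 0) : Module.finrank ℂ A = 0 := by
  rw [Module.finrank_zero_iff]
  refine subsingleton_of_forall_eq 0 fun x => ?_
  exact LinearMap.congr_fun (congrArg homToLinearMap h) x

/-- A representation of a finite group that is not simple is either zero or a direct sum of two
nonzero representations. -/
theorem finrank_eq_zero_or_exists_splitting [Finite G] (hW : ¬ Simple W) :
    Module.finrank ℂ W = 0 ∨ ∃ (A B : FDRep ℂ G) (i : A ⟶ W) (r : W ⟶ A) (j : B ⟶ W)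
      (s : W ⟶ B), i ≫ r = 𝟙 A ∧ j ≫ s = 𝟙 B ∧ j ≫ r = 0 ∧ i ≫ s = 0 ∧
      r ≫ i + s ≫ j = 𝟙 W ∧ Module.finrank ℂ A ≠ 0 ∧ Module.finrank ℂ B ≠ 0 := by
  have : NeZero (Nat.card G : ℂ) := ⟨by exact_mod_cast Nat.card_pos.ne'⟩
  by_contra! hcon
  obtain ⟨hne, hcon⟩ := hcon
  refine hW ⟨fun {A} i _ => ⟨fun hi h0 => hne ?_, fun h0 => ?_⟩⟩
  · apply finrank_eq_zero_of_id_eq_zero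
    simpa [h0] using (IsIso.inv_hom_id i).symm
  · obtain ⟨r, hr⟩ : ∃ r, i ≫ r = 𝟙 A := ⟨_, Injective.comp_factorThru (𝟙 A) i⟩
    have hz : (𝟙 W - r ≫ i) ≫ r = 0 := by simp [hr]
    have key := hcon A (kernel r) i r (kernel.ι r) (kernel.lift r _ hz) hr
      (by rw [← cancel_mono (kernel.ι r)]; simp) (by simp)
      (by rw [← cancel_mono (kernel.ι r)]
          rw [Category.assoc, kernel.lift_ι, Preadditive.comp_sub, ← Category.assoc, hr]; simp)
      (by simp)
      (fun h => h0 (hom_eq_zero_of_finrank_eq_zero h i))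
    have hι := hom_eq_zero_of_finrank_eq_zero key (kernel.ι r)
    have hs := kernel.lift_ι r _ hz
    rw [hι, comp_zero] at hs
    exact ⟨r, hr, (sub_eq_zero.mp hs.symm).symm⟩

/-- The dimension of a representation of a finite group is the sum of the dimensions of the
irreducible representations weighted by their multiplicities. -/
theorem finrank_eq_sum_finrank_hom_mul [Finite G] {ι : Type*} [Fintype ι] (V : ι → FDRep ℂ G)
    (hs : ∀ l, Simple (V l)) (hinj : ∀ l m, Nonempty (V l ≅ V m) → l = m)
    (hex : ∀ W : FDRep ℂ G, Simple W → ∃ l, Nonempty (W ≅ V l)) (W : FDRep ℂ G) :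
    Module.finrank ℂ W = ∑ l, Module.finrank ℂ (W ⟶ V l) * Module.finrank ℂ (V l) := by
  classical
  induction hd : Module.finrank ℂ W using Nat.strong_induction_on generalizing W with
  | _ d ih =>
  subst hd
  by_cases hW : Simple W
  · obtain ⟨m, ⟨e⟩⟩ := hex W hW
    rw [Finset.sum_eq_single m]
    · rw [finrank_hom_simple_simple, if_pos ⟨e⟩, one_mul]
      exact (isoToLinearEquiv e).finrank_eq
    · intro l _ hl
      rw [finrank_hom_simple_simple, if_neg, zero_mul]
      rintro ⟨e'⟩
      exact hl (hinj l m ⟨e'.symm ≪≫ e⟩)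
    · simp
  · obtain h0 | ⟨A, B, i, r, j, s, hir, hjs, hjr, his, hsum, hA, hB⟩ :=
      finrank_eq_zero_or_exists_splitting hW
    · rw [h0, Finset.sum_eq_zero]
      intro l _
      have : Subsingleton (W ⟶ V l) := subsingleton_of_forall_eq 0
        (hom_eq_zero_of_finrank_eq_zero h0)
      rw [Module.finrank_zero_of_subsingleton, zero_mul]
    · have hd := finrank_eq_add_of_splitting i r j s hir hjs hjr his hsum
      simp_rw [finrank_hom_eq_add_of_splitting i r j s hir hjs hjr his hsum, add_mul,
        Finset.sum_add_distrib]
      rw [hd, ← ih _ (by omega) A rfl, ← ih _ (by omega) B rfl]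

/-- The left regular representation of a finite group as a finite-dimensional representation. -/
noncomputable def leftRegular (G : Type) [Group G] [Finite G] : FDRep ℂ G :=
  FDRep.of (Representation.leftRegular ℂ G)

theorem finrank_leftRegular_hom [Finite G] (W : FDRep ℂ G) :
    Module.finrank ℂ (leftRegular G ⟶ W) = Module.finrank ℂ W := by
  refine LinearEquiv.finrank_eq ?_
  exact (forget₂HomLinearEquiv (leftRegular G) W).symm ≪≫ₗ
    Rep.leftRegularHomEquiv ((forget₂ (FDRep ℂ G) (Rep ℂ G)).obj W)

/-- The squares of the dimensions of the irreducible representations sum to the group order. -/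
theorem sum_sq_finrank_eq_card [Finite G] {ι : Type*} [Fintype ι] (V : ι → FDRep ℂ G)
    (hs : ∀ l, Simple (V l)) (hinj : ∀ l m, Nonempty (V l ≅ V m) → l = m)
    (hex : ∀ W : FDRep ℂ G, Simple W → ∃ l, Nonempty (W ≅ V l)) :
    ∑ l, Module.finrank ℂ (V l) ^ 2 = Nat.card G := by
  have := Fintype.ofFinite G
  have h := finrank_eq_sum_finrank_hom_mul V hs hinj hex (leftRegular G)
  simp_rw [finrank_leftRegular_hom, ← sq] at h
  rw [← h, Nat.card_eq_fintype_card]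
  exact (MonoidAlgebra.coeffLinearEquiv ℂ (S := ℂ) (M := G)).finrank_eq.trans
    (Module.finrank_finsupp_self ℂ)

end FDRep

theorem sq_dimRep_le {n : ℕ} {V : Nat.Partition n → FDRep ℂ (SymGrp n)} (hV : IsIrrFamily V)
    (l : Nat.Partition n) : dimRep (V l) ^ 2 ≤ maxKron V * ∑ m, dimRep (V m) := by
  have h := FDRep.finrank_eq_sum_finrank_hom_mul V hV.1 hV.2.1 hV.2.2
    (MonoidalCategoryStruct.tensorObj (V l) (V l))
  have ht : Module.finrank ℂ (MonoidalCategoryStruct.tensorObj (V l) (V l) : FDRep ℂ (SymGrp n))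
      = dimRep (V l) * dimRep (V l) :=
    Module.finrank_tensorProduct (R := ℂ) (S := ℂ) (M := V l) (M' := V l)
  rw [sq, ← ht, h, Finset.mul_sum]
  refine Finset.sum_le_sum fun m _ => Nat.mul_le_mul_right _ ?_
  exact Finset.le_sup (f := fun t : Nat.Partition n × Nat.Partition n × Nat.Partition n =>
    kron V t.1 t.2.1 t.2.2) (Finset.mem_univ (m, l, l))

theorem sum_dimRep_le {n : ℕ} {V : Nat.Partition n → FDRep ℂ (SymGrp n)} (hV : IsIrrFamily V) :
    ((∑ m, dimRep (V m) : ℕ) : ℝ) ≤ Real.sqrt ((numPart n : ℝ) * Nat.factorial n) := by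
  apply Real.le_sqrt_of_sq_le
  have h := FDRep.sum_sq_finrank_eq_card V hV.1 hV.2.1 hV.2.2
  rw [Nat.card_eq_fintype_card, Fintype.card_perm, Fintype.card_fin] at h
  rw [← h]
  rw [numPart, ← Finset.card_univ]
  exact_mod_cast sq_sum_le_card_mul_sum_sq (s := Finset.univ) (f := fun m => dimRep (V m))

/-- `K(n) ≥ D(n)² / √(p(n)·n!)`. -/
theorem stmt7 (n : ℕ) (V : Nat.Partition n → FDRep ℂ (SymGrp n)) (hV : IsIrrFamily V) :
    (maxDim V : ℝ) ^ 2 / Real.sqrt ((numPart n : ℝ) * Nat.factorial n) ≤ (maxKron V : ℝ) := by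
  obtain ⟨l, -, hl⟩ := Finset.exists_mem_eq_sup Finset.univ Finset.univ_nonempty
    (fun l : Nat.Partition n => dimRep (V l))
  have hD : maxDim V = dimRep (V l) := hl
  refine div_le_of_le_mul₀ (Real.sqrt_nonneg _) (Nat.cast_nonneg _) ?_
  rw [hD]
  calc (dimRep (V l) : ℝ) ^ 2 ≤ maxKron V * (∑ m, dimRep (V m) : ℕ) := by
        exact_mod_cast sq_dimRep_le hV l
    _ ≤ _ := mul_le_mul_of_nonneg_left (sum_dimRep_le hV) (Nat.cast_nonneg _)
end

section
/- For every 0 ≤ m ≤ n, the sum over λ ⊢ n and μ ⊢ m of (f^{λ/μ})² satisfies (n−1)!/(m−1)! ≤ Σ_{λ⊢n, μ⊢m} (f^{λ/μ})² ≤ (n!/m!)·p(m), where p(m) is the number of partitions of m. -/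
/-- The cells `(i,j)` (row `i`, column `j`, both `0`-indexed) of the Young diagram of a
partition `λ`: `(i,j)` is a cell iff `λ` has more than `i` parts exceeding `j`. -/
def cellsOf {n : ℕ} (l : Nat.Partition n) : Finset (ℕ × ℕ) :=
  (Finset.range n ×ˢ Finset.range n).filter
    (fun c => c.1 < Multiset.card (l.parts.filter (fun p => c.2 < p)))

/-- The number `f^{λ/μ}` of standard Young tableaux of the skew shape `λ/μ`: bijective
labelings of the cells of `λ` not in `μ` by `0,…,n-m-1`, increasing along rows and columns.
(It is `0` unless `μ ⊆ λ`.) -/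
noncomputable def skewSYT {n m : ℕ} (l : Nat.Partition n) (mu : Nat.Partition m) : ℕ :=
  Nat.card {T : {c // c ∈ cellsOf l \ cellsOf mu} → Fin (n - m) //
    Function.Bijective T ∧
    (∀ a b : {c // c ∈ cellsOf l \ cellsOf mu},
      a.1.1 = b.1.1 → a.1.2 < b.1.2 → T a < T b) ∧
    (∀ a b : {c // c ∈ cellsOf l \ cellsOf mu},
      a.1.2 = b.1.2 → a.1.1 < b.1.1 → T a < T b)}

theorem Multiset.sum_range_card_filter_lt (n : ℕ) (s : Multiset ℕ) (hs : ∀ p ∈ s, p ≤ n) :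
    ∑ j ∈ Finset.range n, (s.filter (fun p => j < p)).card = s.sum := by
  induction s using Multiset.induction with
  | empty => simp
  | cons a s ih =>
    have ha : a ≤ n := hs a (Multiset.mem_cons_self a s)
    have hcard : ∀ j, ((a ::ₘ s).filter (fun p => j < p)).card =
        (if j < a then 1 else 0) + (s.filter (fun p => j < p)).card := by
      intro j
      by_cases h : j < a <;> simp [h, add_comm]
    simp only [hcard]
    rw [Finset.sum_add_distrib, ih fun p hp => hs p (Multiset.mem_cons_of_mem hp),
      Multiset.sum_cons, ← Finset.card_filter]
    congr 1
    have : (Finset.range n).filter (fun j => j < a) = Finset.range a := by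
      ext j
      simp only [Finset.mem_filter, Finset.mem_range]
      omega
    rw [this, Finset.card_range]

theorem Multiset.card_filter_lt_eq_count_add (s : Multiset ℕ) (j : ℕ) :
    (s.filter (fun p => j < p)).card =
      s.count (j + 1) + (s.filter (fun p => j + 1 < p)).card := by
  induction s using Multiset.induction with
  | empty => simp
  | cons a s ih =>
    rcases lt_trichotomy a (j + 1) with h | h | h
    · simp [h.not_gt, h.ne', show ¬ j < a by omega, ih]
    · subst h
      simp only [Multiset.count_cons, lt_add_iff_pos_right, zero_lt_one,
        Multiset.filter_cons_of_pos, Multiset.card_cons, ih, lt_self_iff_false,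
        not_false_eq_true, Multiset.filter_cons_of_neg, if_true]
      omega
    · simp only [Multiset.count_cons, h, h.ne, show j < a by omega,
        Multiset.filter_cons_of_pos, Multiset.card_cons, ih, if_false]
      omega

theorem Nat.Partition.card_parts_le {n : ℕ} (l : Nat.Partition n) : l.parts.card ≤ n := by
  have h : ∀ s : Multiset ℕ, (∀ p ∈ s, 1 ≤ p) → s.card ≤ s.sum := by
    intro s hs
    simpa using Multiset.card_nsmul_le_sum hs
  simpa only [l.parts_sum] using h l.parts fun p hp => l.parts_pos hp

theorem mem_cellsOf {n : ℕ} (l : Nat.Partition n) (c : ℕ × ℕ) :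
    c ∈ cellsOf l ↔ c.1 < (l.parts.filter (fun p => c.2 < p)).card := by
  simp only [cellsOf, Finset.mem_filter, Finset.mem_product, Finset.mem_range,
    and_iff_right_iff_imp]
  intro h
  refine ⟨h.trans_le ((Multiset.card_le_card (Multiset.filter_le _ _)).trans l.card_parts_le), ?_⟩
  obtain ⟨p, hp⟩ := Multiset.card_pos_iff_exists_mem.1 (Nat.zero_lt_of_lt h)
  rw [Multiset.mem_filter] at hp
  exact hp.2.trans_le (l.le_of_mem_parts hp.1)

/-- The Young diagram of a partition. -/
def Nat.Partition.youngDiagram {n : ℕ} (l : Nat.Partition n) : YoungDiagram where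
  cells := cellsOf l
  isLowerSet := by
    rintro ⟨i, j⟩ ⟨i', j'⟩ ⟨hi, hj⟩ h
    simp only at hi hj
    rw [Finset.mem_coe, mem_cellsOf] at h ⊢
    refine (hi.trans_lt h).trans_le (Multiset.card_le_card ?_)
    exact Multiset.monotone_filter_right _ fun p hp => hj.trans_lt hp

theorem Nat.Partition.card_youngDiagram {n : ℕ} (l : Nat.Partition n) :
    l.youngDiagram.card = n := by
  have hle : ∀ p ∈ l.parts, p ≤ n := fun p hp => l.le_of_mem_parts hp
  have hmaps : Set.MapsTo Prod.snd (cellsOf l : Set (ℕ × ℕ)) (Finset.range n : Set ℕ) := by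
    intro c hc
    simp only [cellsOf, Finset.mem_coe, Finset.mem_filter, Finset.mem_product] at hc
    exact hc.1.2
  change (cellsOf l).card = n
  rw [Finset.card_eq_sum_card_fiberwise hmaps]
  conv_rhs => rw [← l.parts_sum, ← Multiset.sum_range_card_filter_lt n l.parts hle]
  refine Finset.sum_congr rfl fun j _ => ?_
  have : (cellsOf l).filter (fun c => c.2 = j) =
      (Finset.range (l.parts.filter (fun p => j < p)).card) ×ˢ {j} := by
    ext ⟨i, k⟩
    simp only [Finset.mem_filter, mem_cellsOf, Finset.mem_product, Finset.mem_range,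
      Finset.mem_singleton]
    constructor
    · rintro ⟨h, rfl⟩
      exact ⟨h, rfl⟩
    · rintro ⟨h, rfl⟩
      exact ⟨h, rfl⟩
  rw [this]
  simp

theorem Nat.Partition.youngDiagram_injective (n : ℕ) :
    Function.Injective (Nat.Partition.youngDiagram : Nat.Partition n → YoungDiagram) := by
  intro l l' h
  have hcells : ∀ c, c ∈ cellsOf l ↔ c ∈ cellsOf l' := fun c => by
    have := congrArg YoungDiagram.cells h
    change cellsOf l = cellsOf l' at this
    rw [this]
  have hcard : ∀ j, (l.parts.filter (fun p => j < p)).card =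
      (l'.parts.filter (fun p => j < p)).card := by
    intro j
    refine eq_of_forall_lt_iff fun i => ?_
    simpa only [mem_cellsOf] using hcells (i, j)
  ext p
  cases p with
  | zero =>
    rw [Multiset.count_eq_zero_of_notMem fun h => (l.parts_pos h).ne rfl,
      Multiset.count_eq_zero_of_notMem fun h => (l'.parts_pos h).ne rfl]
  | succ j =>
    have h1 := l.parts.card_filter_lt_eq_count_add j
    have h2 := l'.parts.card_filter_lt_eq_count_add j
    rw [hcard j, hcard (j + 1)] at h1
    omega

theorem YoungDiagram.card_eq_sum_rowLen (Y : YoungDiagram) :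
    Y.card = ∑ i ∈ Finset.range (Y.colLen 0), Y.rowLen i := by
  have hmaps : Set.MapsTo Prod.fst (Y.cells : Set (ℕ × ℕ))
      (Finset.range (Y.colLen 0) : Set ℕ) := by
    rintro ⟨i, j⟩ hc
    rw [Finset.coe_range, Set.mem_Iio, ← YoungDiagram.mem_iff_lt_colLen]
    exact Y.up_left_mem le_rfl (Nat.zero_le j) hc
  rw [YoungDiagram.card, Finset.card_eq_sum_card_fiberwise hmaps]
  simp only [YoungDiagram.rowLen_eq_card, YoungDiagram.row]

theorem Nat.Partition.exists_youngDiagram_eq (Y : YoungDiagram) {n : ℕ} (hY : Y.card = n) :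
    ∃ l : Nat.Partition n, l.youngDiagram = Y := by
  refine ⟨⟨(Y.rowLens : Multiset ℕ), fun {i} hi => Y.pos_of_mem_rowLens i hi, ?_⟩, ?_⟩
  · rw [← hY, Y.card_eq_sum_rowLen]
    rfl
  · ext ⟨i, j⟩
    change _ ∈ cellsOf _ ↔ _
    rw [mem_cellsOf, YoungDiagram.mem_cells, YoungDiagram.mem_iff_lt_colLen]
    have : ((Y.rowLens : Multiset ℕ).filter (fun p => j < p)).card = Y.colLen j := by
      have h1 : (Y.rowLens : Multiset ℕ) = (Finset.range (Y.colLen 0)).val.map Y.rowLen := rfl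
      rw [h1, Multiset.filter_map, Multiset.card_map]
      have h2 : (Finset.range (Y.colLen 0)).filter (fun i => j < Y.rowLen i) =
          Finset.range (Y.colLen j) := by
        ext k
        simp only [Finset.mem_filter, Finset.mem_range, ← YoungDiagram.mem_iff_lt_colLen,
          ← YoungDiagram.mem_iff_lt_rowLen, and_iff_right_iff_imp]
        exact fun h => Y.up_left_mem le_rfl (Nat.zero_le j) h
      conv_rhs => rw [← Finset.card_range (Y.colLen j), ← h2]
      rfl
    rw [this]

theorem Nat.Partition.card_le_card_succ (m : ℕ) :
    Fintype.card (Nat.Partition m) ≤ Fintype.card (Nat.Partition (m + 1)) := by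
  refine Fintype.card_le_of_injective
    (fun l : Nat.Partition m => (⟨1 ::ₘ l.parts, fun {i} hi => ?_, ?_⟩ : Nat.Partition (m + 1)))
    fun l l' h => ?_
  · rcases Multiset.mem_cons.1 hi with rfl | hi
    · exact one_pos
    · exact l.parts_pos hi
  · rw [Multiset.sum_cons, l.parts_sum, add_comm]
  · have := congrArg Nat.Partition.parts h
    simp only [Multiset.cons_inj_right] at this
    exact Nat.Partition.ext this

namespace YoungDiagram

theorem eq_of_le_of_card_le {X Y : YoungDiagram} (h : X ≤ Y) (hc : Y.card ≤ X.card) : X = Y :=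
  YoungDiagram.ext (Finset.eq_of_subset_of_card_le h hc)

theorem exists_cells_eq_insert {X Y : YoungDiagram} (h : X ≤ Y) (hc : Y.card = X.card + 1) :
    ∃ c, c ∉ X ∧ Y.cells = insert c X.cells := by
  have h1 : X.cells ⊆ Y.cells := h
  have h2 : (Y.cells \ X.cells).card = 1 := by
    rw [Finset.card_sdiff_of_subset h1]
    change Y.card - X.card = 1
    omega
  obtain ⟨c, hcc⟩ := Finset.card_eq_one.1 h2
  have h3 : c ∈ Y.cells \ X.cells := by simp [hcc]
  refine ⟨c, (Finset.mem_sdiff.1 h3).2, ?_⟩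
  rw [← Finset.union_sdiff_of_subset h1, hcc, Finset.union_comm, Finset.insert_eq]

/-- The diagram obtained by adding a cell at the end of row `i`. -/
def addCell (X : YoungDiagram) (i : ℕ) (h : ∀ k < i, X.rowLen i < X.rowLen k) :
    YoungDiagram where
  cells := insert (i, X.rowLen i) X.cells
  isLowerSet := by
    rintro ⟨a, b⟩ ⟨a', b'⟩ ⟨ha, hb⟩ hab
    simp only at ha hb
    rw [Finset.mem_coe, Finset.mem_insert] at hab ⊢
    rcases hab with hab | hab
    · obtain ⟨rfl, rfl⟩ := Prod.mk.inj hab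
      rcases ha.lt_or_eq with ha | rfl
      · exact Or.inr (mem_iff_lt_rowLen.2 (hb.trans_lt (h _ ha)))
      · rcases hb.lt_or_eq with hb | rfl
        · exact Or.inr (mem_iff_lt_rowLen.2 hb)
        · exact Or.inl rfl
    · exact Or.inr (X.up_left_mem ha hb hab)

/-- The diagram obtained by removing the last cell of row `i`. -/
def removeCell (X : YoungDiagram) (i : ℕ) (h : X.rowLen (i + 1) < X.rowLen i) :
    YoungDiagram where
  cells := X.cells.erase (i, X.rowLen i - 1)
  isLowerSet := by
    rintro ⟨a, b⟩ ⟨a', b'⟩ ⟨ha, hb⟩ hab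
    simp only at ha hb
    rw [Finset.mem_coe, Finset.mem_erase] at hab ⊢
    refine ⟨?_, X.up_left_mem ha hb hab.2⟩
    intro heq
    obtain ⟨rfl, rfl⟩ := Prod.mk.inj heq
    have hb2 : b < X.rowLen a := mem_iff_lt_rowLen.1 hab.2
    rcases ha.lt_or_eq with ha | rfl
    · have := X.rowLen_anti _ _ (Nat.succ_le_of_lt ha)
      simp only [Nat.succ_eq_add_one] at this
      omega
    · exact hab.1 (Prod.ext rfl (by simp only; omega))

theorem ncard_upper_covers (X : YoungDiagram) :
    {Y : YoungDiagram | Y.card = X.card + 1 ∧ X ≤ Y}.ncard =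
      {i : ℕ | ∀ k < i, X.rowLen i < X.rowLen k}.ncard := by
  symm
  refine Set.ncard_congr (fun i hi => X.addCell i hi) ?_ ?_ ?_
  · intro i hi
    refine ⟨Finset.card_insert_of_notMem ?_, Finset.subset_insert _ _⟩
    rw [mem_cells, mem_iff_lt_rowLen]
    exact lt_irrefl _
  · intro i j hi hj hij
    have h1 : (i, X.rowLen i) ∈ (X.addCell j hj).cells := by
      rw [← hij]
      exact Finset.mem_insert_self _ _
    rcases Finset.mem_insert.1 h1 with h | h
    · exact (Prod.mk.inj h).1
    · rw [mem_cells, mem_iff_lt_rowLen] at h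
      exact absurd h (lt_irrefl _)
  · rintro Y ⟨hc, hle⟩
    obtain ⟨⟨i, j⟩, hX, hY⟩ := exists_cells_eq_insert hle hc
    have hmem : (i, j) ∈ Y := by
      rw [← mem_cells, hY]
      exact Finset.mem_insert_self _ _
    have hj : j = X.rowLen i := by
      refine le_antisymm ?_ (not_lt.1 fun h => hX (mem_iff_lt_rowLen.2 h))
      by_contra! hlt
      have : (i, X.rowLen i) ∈ Y := Y.up_left_mem le_rfl hlt.le hmem
      rw [← mem_cells, hY, Finset.mem_insert, mem_cells, mem_iff_lt_rowLen] at this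
      rcases this with h | h
      · have := (Prod.mk.inj h).2
        omega
      · exact lt_irrefl _ h
    subst hj
    refine ⟨i, ?_, YoungDiagram.ext hY.symm⟩
    intro k hk
    have : (k, X.rowLen i) ∈ Y := Y.up_left_mem hk.le le_rfl hmem
    rw [← mem_cells, hY, Finset.mem_insert, mem_cells, mem_iff_lt_rowLen] at this
    rcases this with h | h
    · have := (Prod.mk.inj h).1
      omega
    · exact h

theorem ncard_lower_covers (X : YoungDiagram) :
    {Y : YoungDiagram | Y.card + 1 = X.card ∧ Y ≤ X}.ncard =
      {i : ℕ | X.rowLen (i + 1) < X.rowLen i}.ncard := by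
  symm
  have hlast : ∀ i, X.rowLen (i + 1) < X.rowLen i → (i, X.rowLen i - 1) ∈ X.cells := by
    intro i hi
    rw [mem_cells, mem_iff_lt_rowLen]
    omega
  refine Set.ncard_congr (fun i hi => X.removeCell i hi) ?_ ?_ ?_
  · intro i hi
    exact ⟨Finset.card_erase_add_one (hlast i hi), Finset.erase_subset _ _⟩
  · intro i j hi hj hij
    by_contra hne
    have h1 : (i, X.rowLen i - 1) ∈ (X.removeCell j hj).cells :=
      Finset.mem_erase.2 ⟨fun h => hne (Prod.mk.inj h).1, hlast i hi⟩
    rw [← hij] at h1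
    exact (Finset.mem_erase.1 h1).1 rfl
  · rintro Y ⟨hc, hle⟩
    obtain ⟨⟨i, j⟩, hY, hX⟩ := exists_cells_eq_insert hle hc.symm
    have hmem : (i, j) ∈ X := by
      rw [← mem_cells, hX]
      exact Finset.mem_insert_self _ _
    have hup : ∀ a b, i ≤ a → j ≤ b → (a, b) ∈ X → a = i ∧ b = j := by
      intro a b ha hb hab
      rw [← mem_cells, hX, Finset.mem_insert] at hab
      rcases hab with h | h
      · exact Prod.mk.inj h
      · exact absurd (Y.up_left_mem ha hb h) hY
    have h1 : j < X.rowLen i := mem_iff_lt_rowLen.1 hmem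
    have h2 : ¬ j + 1 < X.rowLen i := fun h => by
      have := (hup i (j + 1) le_rfl (Nat.le_succ j) (mem_iff_lt_rowLen.2 h)).2
      omega
    have h3 : ¬ j < X.rowLen (i + 1) := fun h => by
      have := (hup (i + 1) j (Nat.le_succ i) le_rfl (mem_iff_lt_rowLen.2 h)).1
      omega
    have hj : X.rowLen i - 1 = j := by omega
    refine ⟨i, by rw [Set.mem_ofPred_eq]; omega, YoungDiagram.ext ?_⟩
    change X.cells.erase (i, X.rowLen i - 1) = Y.cells
    rw [hj, hX, Finset.erase_insert hY]

theorem ncard_upper_covers_eq_lower_covers_add_one (X : YoungDiagram) :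
    {Y : YoungDiagram | Y.card = X.card + 1 ∧ X ≤ Y}.ncard =
      {Y : YoungDiagram | Y.card + 1 = X.card ∧ Y ≤ X}.ncard + 1 := by
  rw [ncard_upper_covers, ncard_lower_covers]
  have hfin : {i : ℕ | X.rowLen (i + 1) < X.rowLen i}.Finite := by
    refine (Set.finite_Iio (X.colLen 0)).subset fun i hi => ?_
    rw [Set.mem_Iio, ← mem_iff_lt_colLen, mem_iff_lt_rowLen]
    exact Nat.zero_lt_of_lt hi
  have heq : {i : ℕ | ∀ k < i, X.rowLen i < X.rowLen k} =
      insert 0 (Nat.succ '' {i : ℕ | X.rowLen (i + 1) < X.rowLen i}) := by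
    ext i
    cases i with
    | zero => simp
    | succ i =>
      simp only [Set.mem_ofPred_eq, Set.mem_insert_iff, Nat.add_eq_zero_iff, one_ne_zero, and_false,
        false_or, Set.mem_image, Nat.succ_eq_add_one, add_left_inj, exists_eq_right]
      refine ⟨fun h => h i (Nat.lt_succ_self i), fun h k hk => h.trans_le ?_⟩
      exact X.rowLen_anti k i (Nat.lt_succ_iff.1 hk)
  rw [heq, Set.ncard_insert_of_notMem (by simp) (hfin.image _),
    Set.ncard_image_of_injective _ Nat.succ_injective]

/-- Young's lattice is a differential poset. -/
theorem ncard_common_upper_covers [DecidableEq YoungDiagram] {X Y : YoungDiagram}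
    (h : X.card = Y.card) :
    {Z : YoungDiagram | Z.card = X.card + 1 ∧ X ≤ Z ∧ Y ≤ Z}.ncard =
      {Z : YoungDiagram | Z.card + 1 = X.card ∧ Z ≤ X ∧ Z ≤ Y}.ncard +
        if X = Y then 1 else 0 := by
  by_cases hXY : X = Y
  · subst hXY
    simpa using ncard_upper_covers_eq_lower_covers_add_one X
  have hsum : (X ⊔ Y).card + (X ⊓ Y).card = X.card + X.card := by
    conv_rhs => rw [h]
    conv_rhs => lhs; rw [← h]
    exact Finset.card_union_add_card_inter X.cells Y.cells
  have hlt : X.card < (X ⊔ Y).card := by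
    by_contra! hle
    have h1 : X = X ⊔ Y := eq_of_le_of_card_le le_sup_left hle
    have h2 : Y ≤ X := h1 ▸ le_sup_right
    exact hXY (eq_of_le_of_card_le h2 h.le).symm
  rw [if_neg hXY, add_zero]
  by_cases hc : (X ⊔ Y).card = X.card + 1
  · have h1 : {Z : YoungDiagram | Z.card = X.card + 1 ∧ X ≤ Z ∧ Y ≤ Z} = {X ⊔ Y} := by
      ext Z
      simp only [Set.mem_ofPred_eq, Set.mem_singleton_iff, ← sup_le_iff]
      constructor
      · rintro ⟨hZ, hle⟩
        exact (eq_of_le_of_card_le hle (hZ.trans hc.symm).le).symm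
      · rintro rfl
        exact ⟨hc, le_rfl⟩
    have h2 : {Z : YoungDiagram | Z.card + 1 = X.card ∧ Z ≤ X ∧ Z ≤ Y} = {X ⊓ Y} := by
      ext Z
      simp only [Set.mem_ofPred_eq, Set.mem_singleton_iff, ← le_inf_iff]
      constructor
      · rintro ⟨hZ, hle⟩
        exact eq_of_le_of_card_le hle (by omega)
      · rintro rfl
        exact ⟨by omega, le_rfl⟩
    rw [h1, h2, Set.ncard_singleton, Set.ncard_singleton]
  · have h1 : {Z : YoungDiagram | Z.card = X.card + 1 ∧ X ≤ Z ∧ Y ≤ Z} = ∅ := by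
      refine Set.eq_empty_of_forall_notMem fun Z ⟨hZ, hX, hY⟩ => ?_
      have : (X ⊔ Y).card ≤ Z.card := Finset.card_le_card (sup_le hX hY)
      omega
    have h2 : {Z : YoungDiagram | Z.card + 1 = X.card ∧ Z ≤ X ∧ Z ≤ Y} = ∅ := by
      refine Set.eq_empty_of_forall_notMem fun Z ⟨hZ, hX, hY⟩ => ?_
      have : Z.card ≤ (X ⊓ Y).card := Finset.card_le_card (le_inf hX hY)
      omega
    rw [h1, h2]

end YoungDiagram

namespace YoungDiagram

/-- Standard fillings of `X \ M` by `0, …, r - 1`, extended by zero to all of `ℕ × ℕ`. -/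
def skewTableaux (X M : YoungDiagram) (r : ℕ) : Set (ℕ × ℕ → ℕ) :=
  {f | (∀ c, c ∉ X.cells \ M.cells → f c = 0) ∧
    Set.BijOn f ↑(X.cells \ M.cells) (Set.Iio r) ∧
    StrictMonoOn f ↑(X.cells \ M.cells)}

theorem card_sdiff_of_mem_skewTableaux {X M : YoungDiagram} {r : ℕ} {f : ℕ × ℕ → ℕ}
    (hf : f ∈ skewTableaux X M r) : (X.cells \ M.cells).card = r := by
  have h := hf.2.1.image_eq
  rw [← Finset.card_image_of_injOn hf.2.1.injOn, ← Finset.card_range r]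
  congr 1
  rw [← Finset.coe_inj, Finset.coe_image, h, Finset.coe_range]

theorem le_of_mem_skewTableaux {X M : YoungDiagram} {r : ℕ} {f : ℕ × ℕ → ℕ}
    (hf : f ∈ skewTableaux X M r) (hc : X.card = M.card + r) : M ≤ X := by
  have h1 := card_sdiff_of_mem_skewTableaux hf
  have h2 := Finset.card_sdiff_add_card_inter X.cells M.cells
  have h3 : M.cells.card ≤ (X.cells ∩ M.cells).card := by
    change _ = X.card at h2
    change M.card ≤ _
    omega
  have h4 := Finset.eq_of_subset_of_card_le Finset.inter_subset_right h3
  exact Finset.inter_eq_right.1 h4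

/-- Restricting a filling to `X \ M` gives a labeling as in `skewSYT`. -/
theorem card_skewTableaux {X M : YoungDiagram} (r : ℕ) :
    Nat.card {T : {c // c ∈ X.cells \ M.cells} → Fin r //
      Function.Bijective T ∧
      (∀ a b : {c // c ∈ X.cells \ M.cells}, a.1.1 = b.1.1 → a.1.2 < b.1.2 → T a < T b) ∧
      (∀ a b : {c // c ∈ X.cells \ M.cells}, a.1.2 = b.1.2 → a.1.1 < b.1.1 → T a < T b)} =
    Nat.card (skewTableaux X M r) := by
  classical
  refine Nat.card_congr (Equiv.ofBijective
    (fun T => ⟨fun c => if h : c ∈ X.cells \ M.cells then (T.1 ⟨c, h⟩ : ℕ) else 0, ?_⟩) ⟨?_, ?_⟩)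
  · obtain ⟨T, hT, hrow, hcol⟩ := T
    refine ⟨fun c hc => dif_neg hc, ⟨?_, ?_, ?_⟩, ?_⟩
    · intro c hc
      simp only [dif_pos (Finset.mem_coe.1 hc)]
      exact (T _).2
    · intro a ha b hb hab
      simp only [dif_pos (Finset.mem_coe.1 ha), dif_pos (Finset.mem_coe.1 hb)] at hab
      exact congrArg Subtype.val (hT.1 (Fin.ext hab))
    · intro k hk
      obtain ⟨⟨c, hc⟩, h⟩ := hT.2 ⟨k, hk⟩
      refine ⟨c, hc, ?_⟩
      simp only [dif_pos hc, h]
    · rintro ⟨i, j⟩ ha ⟨i', j'⟩ hb hab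
      simp only [dif_pos (Finset.mem_coe.1 ha), dif_pos (Finset.mem_coe.1 hb), Fin.val_fin_lt]
      rw [Finset.mem_coe] at ha hb
      obtain ⟨hi, hj⟩ := Prod.mk_le_mk.1 hab.le
      have hm : (i, j') ∈ X.cells \ M.cells := by
        rw [Finset.mem_sdiff] at ha hb ⊢
        exact ⟨X.up_left_mem hi le_rfl hb.1, fun h => ha.2 (M.up_left_mem le_rfl hj h)⟩
      rcases hi.lt_or_eq with hi | rfl
      · refine lt_of_le_of_lt ?_ (hcol ⟨_, hm⟩ ⟨_, hb⟩ rfl hi)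
        rcases hj.lt_or_eq with hj | rfl
        · exact (hrow ⟨_, ha⟩ ⟨_, hm⟩ rfl hj).le
        · exact le_rfl
      · refine hrow ⟨_, ha⟩ ⟨_, hb⟩ rfl (hj.lt_of_ne ?_)
        rintro rfl
        exact lt_irrefl _ hab
  · intro T T' h
    apply Subtype.ext
    funext ⟨c, hc⟩
    have := congrFun (congrArg Subtype.val h) c
    simp only [dif_pos hc] at this
    exact Fin.ext this
  · rintro ⟨f, h0, hbij, hmono⟩
    refine ⟨⟨fun c => ⟨f c.1, hbij.mapsTo c.2⟩, ⟨?_, ?_⟩, ?_, ?_⟩, ?_⟩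
    · intro a b hab
      exact Subtype.ext (hbij.injOn a.2 b.2 (congrArg Fin.val hab))
    · rintro ⟨k, hk⟩
      obtain ⟨c, hc, rfl⟩ := hbij.surjOn hk
      exact ⟨⟨c, hc⟩, rfl⟩
    · intro a b h1 h2
      exact hmono a.2 b.2 (Prod.lt_iff.2 (Or.inr ⟨h1.le, h2⟩))
    · intro a b h1 h2
      exact hmono a.2 b.2 (Prod.lt_iff.2 (Or.inl ⟨h2, h1.le⟩))
    · apply Subtype.ext
      funext c
      by_cases hc : c ∈ X.cells \ M.cells
      · simp only [dif_pos hc]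
      · simp only [dif_neg hc, h0 c hc]

theorem finite_skewTableaux (X M : YoungDiagram) (r : ℕ) : (skewTableaux X M r).Finite := by
  classical
  refine Set.Finite.of_finite_image (f := fun f => fun c : (X.cells \ M.cells : Finset _) => f c)
    (Set.Finite.subset (Set.Finite.pi' (t := fun _ => Set.Iio r) fun _ => Set.finite_Iio r) ?_) ?_
  · rintro _ ⟨f, hf, rfl⟩ c
    exact hf.2.1.mapsTo c.2
  · intro f hf g hg hfg
    funext c
    by_cases hc : c ∈ X.cells \ M.cells
    · exact congrFun hfg ⟨c, hc⟩
    · rw [hf.1 c hc, hg.1 c hc]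

/-- Place the label `r` on the cell of `X` outside `Y`. -/
theorem extend_mem_skewTableaux {X Y M : YoungDiagram} {r : ℕ} {g : ℕ × ℕ → ℕ}
    (hYX : Y ≤ X) (hXY : X.card = Y.card + 1) (hY : Y.card = M.card + r)
    (hg : g ∈ skewTableaux Y M r) :
    (fun c => if c ∈ X.cells \ Y.cells then r else g c) ∈ skewTableaux X M (r + 1) := by
  have hMY := le_of_mem_skewTableaux hg hY
  obtain ⟨c₀, hc₀, hX⟩ := exists_cells_eq_insert hYX hXY
  have hdiff : X.cells \ Y.cells = {c₀} := by
    rw [hX, Finset.insert_sdiff_of_notMem _ hc₀, Finset.sdiff_self, insert_empty_eq]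
  have hM : c₀ ∉ M.cells := fun h => hc₀ (hMY h)
  have hXM : X.cells \ M.cells = insert c₀ (Y.cells \ M.cells) := by
    rw [hX, Finset.insert_sdiff_of_notMem _ hM]
  have hne : ∀ c ∈ Y.cells \ M.cells, c ≠ c₀ := by
    rintro c hc rfl
    exact hc₀ (Finset.mem_sdiff.1 hc).1
  simp only [hdiff, Finset.mem_singleton]
  rw [skewTableaux, hXM]
  obtain ⟨h0, hbij, hmono⟩ := hg
  refine ⟨?_, ⟨?_, ?_, ?_⟩, ?_⟩
  · intro c hc
    rw [Finset.mem_insert, not_or] at hc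
    exact (if_neg hc.1).trans (h0 c hc.2)
  · intro c hc
    rcases Finset.mem_insert.1 hc with rfl | hc
    · simp
    · have := hbij.mapsTo hc
      simp only [if_neg (hne c hc), Set.mem_Iio] at this ⊢
      omega
  · intro a ha b hb hab
    rw [Finset.mem_coe, Finset.mem_insert] at ha hb
    rcases ha with rfl | ha <;> rcases hb with rfl | hb
    · rfl
    · have := hbij.mapsTo hb
      simp only [if_true, if_neg (hne b hb), Set.mem_Iio] at this hab
      omega
    · have := hbij.mapsTo ha
      simp only [if_true, if_neg (hne a ha), Set.mem_Iio] at this hab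
      omega
    · simp only [if_neg (hne a ha), if_neg (hne b hb)] at hab
      exact hbij.injOn ha hb hab
  · intro k hk
    rcases (Nat.lt_succ_iff.1 hk).lt_or_eq with hk | rfl
    · obtain ⟨c, hc, rfl⟩ := hbij.surjOn hk
      exact ⟨c, Finset.mem_insert_of_mem hc, if_neg (hne c hc)⟩
    · exact ⟨c₀, Finset.mem_insert_self _ _, if_pos rfl⟩
  · intro a ha b hb hab
    rw [Finset.mem_coe, Finset.mem_insert] at ha hb
    rcases ha with rfl | ha <;> rcases hb with rfl | hb
    · exact absurd hab (lt_irrefl _)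
    · exact absurd (Y.isLowerSet hab.le (Finset.mem_sdiff.1 hb).1) hc₀
    · simp only [if_true, if_neg (hne a ha)]
      exact hbij.mapsTo ha
    · simp only [if_neg (hne a ha), if_neg (hne b hb)]
      exact hmono ha hb hab

/-- The cells of `X` outside `Y` are those carrying the largest label. -/
theorem mem_cells_iff_of_extend {X Y M : YoungDiagram} {r : ℕ} {g : ℕ × ℕ → ℕ}
    (hYX : Y ≤ X) (hMY : M ≤ Y) (hg : g ∈ skewTableaux Y M r) (c : ℕ × ℕ) :
    c ∈ Y ↔ c ∈ X ∧ (c ∈ M ∨ (if c ∈ X.cells \ Y.cells then r else g c) ≠ r) := by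
  constructor
  · intro hc
    refine ⟨hYX hc, or_iff_not_imp_left.2 fun hM => ?_⟩
    rw [if_neg fun h => (Finset.mem_sdiff.1 h).2 hc]
    exact (hg.2.1.mapsTo (Finset.mem_sdiff.2 ⟨hc, hM⟩)).ne
  · rintro ⟨hX, hM | hr⟩
    · exact hMY hM
    · by_contra hY
      exact hr (if_pos (Finset.mem_sdiff.2 ⟨hX, hY⟩))

theorem exists_extend_eq {X M : YoungDiagram} {r : ℕ} {f : ℕ × ℕ → ℕ}
    (hf : f ∈ skewTableaux X M (r + 1)) :
    ∃ Y ≤ X, X.card = Y.card + 1 ∧ ∃ g ∈ skewTableaux Y M r,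
      (fun c => if c ∈ X.cells \ Y.cells then r else g c) = f := by
  obtain ⟨h0, hbij, hmono⟩ := hf
  obtain ⟨c₀, hc₀, hr⟩ := hbij.surjOn (Set.mem_Iio.2 (Nat.lt_succ_self r))
  have hc₀' := Finset.mem_sdiff.1 hc₀
  have hlt : ∀ c ∈ X.cells \ M.cells, c ≠ c₀ → f c < r := by
    intro c hc hne
    have h1 : f c < r + 1 := hbij.mapsTo hc
    have h2 : f c ≠ r := fun h => hne (hbij.injOn hc hc₀ (h.trans hr.symm))
    omega
  let Y : YoungDiagram :=
    { cells := X.cells.erase c₀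
      isLowerSet := by
        intro a b hba ha
        rw [Finset.mem_coe, Finset.mem_erase] at ha ⊢
        refine ⟨?_, X.isLowerSet hba ha.2⟩
        rintro rfl
        have ha' : a ∈ X.cells \ M.cells :=
          Finset.mem_sdiff.2 ⟨ha.2, fun h => hc₀'.2 (M.isLowerSet hba h)⟩
        have h1 := hmono hc₀ ha' (lt_of_le_of_ne hba ha.1.symm)
        have h2 := hlt a ha' ha.1
        omega }
  have hdiff : X.cells \ Y.cells = {c₀} := by
    change X.cells \ X.cells.erase c₀ = {c₀}
    exact Finset.sdiff_erase_self hc₀'.1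
  have hYM : Y.cells \ M.cells = (X.cells \ M.cells).erase c₀ := by
    change X.cells.erase c₀ \ M.cells = _
    exact Finset.erase_sdiff_comm _ _ _
  refine ⟨Y, Finset.erase_subset _ _, (Finset.card_erase_add_one hc₀'.1).symm,
    fun c => if c = c₀ then 0 else f c, ?_, ?_⟩
  · rw [skewTableaux, hYM]
    refine ⟨?_, ⟨?_, ?_, ?_⟩, ?_⟩
    · intro c hc
      by_cases h : c = c₀
      · exact if_pos h
      · exact (if_neg h).trans (h0 c fun h' => hc (Finset.mem_erase.2 ⟨h, h'⟩))
    · intro c hc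
      obtain ⟨h1, h2⟩ := Finset.mem_erase.1 hc
      simp only [if_neg h1]
      exact hlt c h2 h1
    · intro a ha b hb hab
      obtain ⟨ha1, ha2⟩ := Finset.mem_erase.1 ha
      obtain ⟨hb1, hb2⟩ := Finset.mem_erase.1 hb
      simp only [if_neg ha1, if_neg hb1] at hab
      exact hbij.injOn ha2 hb2 hab
    · intro k hk
      obtain ⟨c, hc, rfl⟩ := hbij.surjOn (Set.mem_Iio.2 (hk.trans (Nat.lt_succ_self r)))
      have hne : c ≠ c₀ := by
        rintro rfl
        exact (Set.mem_Iio.1 hk).ne hr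
      exact ⟨c, Finset.mem_erase.2 ⟨hne, hc⟩, if_neg hne⟩
    · intro a ha b hb hab
      obtain ⟨ha1, ha2⟩ := Finset.mem_erase.1 ha
      obtain ⟨hb1, hb2⟩ := Finset.mem_erase.1 hb
      simp only [if_neg ha1, if_neg hb1]
      exact hmono ha2 hb2 hab
  · funext c
    simp only [hdiff, Finset.mem_singleton]
    by_cases h : c = c₀
    · rw [if_pos h, h, hr]
    · rw [if_neg h, if_neg h]

theorem card_skewTableaux_succ {n r : ℕ} {X M : YoungDiagram} (hX : X.card = n + 1)
    (hn : n = M.card + r) :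
    Nat.card (skewTableaux X M (r + 1)) =
      Nat.card (Σ l : {l : Nat.Partition n // l.youngDiagram ≤ X},
        skewTableaux l.1.youngDiagram M r) := by
  have hcard : ∀ l : Nat.Partition n, X.card = l.youngDiagram.card + 1 := fun l => by
    rw [l.card_youngDiagram, hX]
  have hcard' : ∀ l : Nat.Partition n, l.youngDiagram.card = M.card + r := fun l => by
    rw [l.card_youngDiagram, hn]
  symm
  refine Nat.card_congr (Equiv.ofBijective
    (fun p => ⟨_, extend_mem_skewTableaux p.1.2 (hcard _) (hcard' _) p.2.2⟩) ⟨?_, ?_⟩)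
  · rintro ⟨⟨l, hl⟩, g, hg⟩ ⟨⟨l', hl'⟩, g', hg'⟩ h
    have h := congrArg Subtype.val h
    simp only at h
    have hll : l = l' := by
      apply Nat.Partition.youngDiagram_injective
      ext c
      rw [mem_cells, mem_cells,
        mem_cells_iff_of_extend hl (le_of_mem_skewTableaux hg (hcard' _)) hg,
        mem_cells_iff_of_extend hl' (le_of_mem_skewTableaux hg' (hcard' _)) hg',
        congrFun h c]
    subst hll
    have hgg : g = g' := by
      funext c
      by_cases hc : c ∈ X.cells \ l.youngDiagram.cells
      · have hc' : c ∉ l.youngDiagram.cells \ M.cells := fun h =>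
          (Finset.mem_sdiff.1 hc).2 (Finset.mem_sdiff.1 h).1
        rw [hg.1 c hc', hg'.1 c hc']
      · simpa only [if_neg hc] using congrFun h c
    subst hgg
    rfl
  · rintro ⟨f, hf⟩
    obtain ⟨Y, hYX, hc, g, hg, rfl⟩ := exists_extend_eq hf
    obtain ⟨l, rfl⟩ := Nat.Partition.exists_youngDiagram_eq (n := n) Y (by omega)
    exact ⟨⟨⟨l, hYX⟩, ⟨g, hg⟩⟩, rfl⟩

end YoungDiagram

open Matrix in
/-- If `A` satisfies the relations of a differential poset from level `m` on, lowering commutes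
past iterated raising up to a multiple of the identity. -/
theorem Matrix.transpose_mul_eq_of_differential {ι : ℕ → Type*} [∀ n, Fintype (ι n)]
    [∀ n, DecidableEq (ι n)] (A : ∀ n, Matrix (ι (n + 1)) (ι n) ℕ) {m : ℕ}
    (S : ∀ n, Matrix (ι n) (ι m) ℕ) (B : Matrix (ι m) (ι m) ℕ)
    (hS : S m = 1) (hSA : ∀ n, m ≤ n → S (n + 1) = A n * S n)
    (hB : (A m)ᵀ * A m = B + 1)
    (hA : ∀ n, (A (n + 1))ᵀ * A (n + 1) = A n * (A n)ᵀ + 1) (k : ℕ) :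
    (A (m + k))ᵀ * S (m + k + 1) = S (m + k) * B + (k + 1) • S (m + k) := by
  induction k with
  | zero =>
    rw [add_zero, hSA m le_rfl, hS, Matrix.mul_one, hB, Matrix.one_mul, zero_add, one_smul]
  | succ k ih =>
    have h1 := hSA (m + k) (Nat.le_add_right m k)
    have h2 := hSA (m + k + 1) (by omega)
    rw [← add_assoc, h2, ← Matrix.mul_assoc, hA, Matrix.add_mul, Matrix.one_mul,
      Matrix.mul_assoc, ih, Matrix.mul_add, ← Matrix.mul_assoc, ← h1, Matrix.mul_smul, ← h1,
      add_smul (k + 1) 1, one_smul]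
    exact add_assoc _ _ _

/-- The matrix of numbers `f^{λ/μ}`. -/
noncomputable def skewMatrix (n m : ℕ) : Matrix (Nat.Partition n) (Nat.Partition m) ℕ :=
  Matrix.of fun l mu => skewSYT l mu

theorem skewSYT_eq_card {n m : ℕ} (l : Nat.Partition n) (mu : Nat.Partition m) :
    skewSYT l mu =
      Nat.card (YoungDiagram.skewTableaux l.youngDiagram mu.youngDiagram (n - m)) :=
  YoungDiagram.card_skewTableaux (X := l.youngDiagram) (M := mu.youngDiagram) (n - m)

theorem skewMatrix_self (n : ℕ) : skewMatrix n n = 1 := by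
  ext l mu
  rw [skewMatrix, Matrix.of_apply, skewSYT_eq_card, Nat.sub_self, Matrix.one_apply]
  split_ifs with h
  · subst h
    have : YoungDiagram.skewTableaux l.youngDiagram l.youngDiagram 0 = {fun _ => 0} := by
      ext f
      simp only [YoungDiagram.skewTableaux, Finset.sdiff_self, Set.mem_ofPred_eq,
        Set.mem_singleton_iff, funext_iff]
      constructor
      · exact fun hf c => hf.1 c (Finset.notMem_empty c)
      · refine fun hf => ⟨fun c _ => hf c, ⟨?_, ?_, ?_⟩, ?_⟩ <;>
        simp [Set.MapsTo, Set.SurjOn, StrictMonoOn]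
    rw [this, Nat.card_unique]
  · rw [Nat.card_eq_zero]
    refine Or.inl (Set.isEmpty_coe_sort.2 (Set.eq_empty_of_forall_notMem fun f hf => h ?_))
    apply Nat.Partition.youngDiagram_injective
    have hc : l.youngDiagram.card = mu.youngDiagram.card := by
      rw [l.card_youngDiagram, mu.card_youngDiagram]
    exact (YoungDiagram.eq_of_le_of_card_le
      (YoungDiagram.le_of_mem_skewTableaux hf hc) hc.le).symm

open scoped Classical in
/-- The covering relation of Young's lattice between levels `n` and `n + 1`. -/
noncomputable def coverMatrix (n : ℕ) : Matrix (Nat.Partition (n + 1)) (Nat.Partition n) ℕ :=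
  Matrix.of fun l mu => if mu.youngDiagram ≤ l.youngDiagram then 1 else 0

theorem skewMatrix_succ {n m : ℕ} (h : m ≤ n) :
    skewMatrix (n + 1) m = coverMatrix n * skewMatrix n m := by
  classical
  ext l mu
  simp only [Matrix.mul_apply, skewMatrix, coverMatrix, Matrix.of_apply, skewSYT_eq_card]
  have hfin : ∀ X : YoungDiagram,
      Finite (YoungDiagram.skewTableaux X mu.youngDiagram (n - m)) := fun X =>
    (YoungDiagram.finite_skewTableaux _ _ _).to_subtype
  rw [Nat.sub_add_comm h, YoungDiagram.card_skewTableaux_succ l.card_youngDiagram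
    (by rw [mu.card_youngDiagram]; omega), Nat.card_sigma]
  simp only [ite_mul, one_mul, zero_mul]
  rw [← Finset.sum_filter]
  have hmem : ∀ x : Nat.Partition n, x ∈ Finset.univ.filter
      (fun x : Nat.Partition n => x.youngDiagram ≤ l.youngDiagram) ↔
        x.youngDiagram ≤ l.youngDiagram := fun x => by simp
  exact (Finset.sum_subtype _ hmem
    fun x => Nat.card (YoungDiagram.skewTableaux x.youngDiagram mu.youngDiagram (n - m))).symm

theorem Nat.Partition.card_filter_youngDiagram (n : ℕ) (p : YoungDiagram → Prop)
    [DecidablePred p] :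
    (Finset.univ.filter fun l : Nat.Partition n => p l.youngDiagram).card =
      {Y : YoungDiagram | Y.card = n ∧ p Y}.ncard := by
  rw [← Set.ncard_coe_finset, ← Set.ncard_image_of_injective _
    (Nat.Partition.youngDiagram_injective n)]
  congr 1
  ext Y
  simp only [Finset.coe_filter, Finset.mem_univ, true_and, Set.mem_image, Set.mem_ofPred_eq]
  constructor
  · rintro ⟨l, hl, rfl⟩
    exact ⟨l.card_youngDiagram, hl⟩
  · rintro ⟨hc, hp⟩
    obtain ⟨l, rfl⟩ := Nat.Partition.exists_youngDiagram_eq Y hc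
    exact ⟨l, hp, rfl⟩

open Matrix in
theorem coverMatrix_transpose_mul_apply {n : ℕ} (l mu : Nat.Partition n) :
    ((coverMatrix n)ᵀ * coverMatrix n) l mu =
      {Z : YoungDiagram | Z.card + 1 = n ∧
        Z ≤ l.youngDiagram ∧ Z ≤ mu.youngDiagram}.ncard + (1 : Matrix _ _ ℕ) l mu := by
  classical
  simp only [Matrix.mul_apply, Matrix.transpose_apply, coverMatrix, Matrix.of_apply, ← ite_and,
    mul_ite, mul_one, mul_zero]
  rw [← Finset.card_filter, Nat.Partition.card_filter_youngDiagram (n + 1)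
    fun Y => mu.youngDiagram ≤ Y ∧ l.youngDiagram ≤ Y]
  have h := YoungDiagram.ncard_common_upper_covers
    (l.card_youngDiagram.trans mu.card_youngDiagram.symm)
  rw [l.card_youngDiagram] at h
  simp only [and_comm (a := mu.youngDiagram ≤ _), h, Matrix.one_apply,
    (Nat.Partition.youngDiagram_injective n).eq_iff]

open Matrix in
theorem coverMatrix_zero_transpose_mul :
    (coverMatrix 0)ᵀ * coverMatrix 0 = 0 + 1 := by
  ext l mu
  simp [coverMatrix_transpose_mul_apply]

open Matrix in
theorem coverMatrix_succ_transpose_mul (n : ℕ) :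
    (coverMatrix (n + 1))ᵀ * coverMatrix (n + 1) = coverMatrix n * (coverMatrix n)ᵀ + 1 := by
  classical
  ext l mu
  rw [coverMatrix_transpose_mul_apply, Matrix.add_apply]
  simp only [Matrix.mul_apply, Matrix.transpose_apply, coverMatrix, Matrix.of_apply, ← ite_and,
    mul_ite, mul_one, mul_zero, add_left_inj]
  rw [← Finset.card_filter, Nat.Partition.card_filter_youngDiagram n
    fun Y => Y ≤ mu.youngDiagram ∧ Y ≤ l.youngDiagram]
  simp only [and_comm (b := _ ≤ l.youngDiagram)]

/-- The sum of `(f^{λ/μ})²` over `λ ⊢ n` and `μ ⊢ m`. -/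
noncomputable def sumSqSkewSYT (n m : ℕ) : ℕ :=
  ∑ l : Nat.Partition n, ∑ mu : Nat.Partition m, (skewSYT l mu) ^ 2

open Matrix in
theorem sumSqSkewSYT_eq_trace (n m : ℕ) :
    sumSqSkewSYT n m = ((skewMatrix n m)ᵀ * skewMatrix n m).trace := by
  rw [sumSqSkewSYT, Finset.sum_comm]
  simp [Matrix.trace, Matrix.mul_apply, skewMatrix, sq]

theorem sumSqSkewSYT_self (n : ℕ) : sumSqSkewSYT n n = Fintype.card (Nat.Partition n) := by
  rw [sumSqSkewSYT_eq_trace, skewMatrix_self, Matrix.transpose_one, Matrix.one_mul,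
    Matrix.trace_one, Nat.cast_id]

theorem skewMatrix_succ_right {n m : ℕ} (h : m + 1 ≤ n) :
    skewMatrix n (m + 1) * coverMatrix m = skewMatrix n m := by
  induction n, h using Nat.le_induction with
  | base => rw [skewMatrix_self, Matrix.one_mul, skewMatrix_succ le_rfl, skewMatrix_self,
      Matrix.mul_one]
  | succ n h ih => rw [skewMatrix_succ h, skewMatrix_succ (by omega), Matrix.mul_assoc, ih]

open Matrix in
theorem sumSqSkewSYT_add_succ {m : ℕ} {B : Matrix (Nat.Partition m) (Nat.Partition m) ℕ}
    (hB : (coverMatrix m)ᵀ * coverMatrix m = B + 1) (k : ℕ) :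
    sumSqSkewSYT (m + k + 1) m =
      ((skewMatrix (m + k) m)ᵀ * (skewMatrix (m + k) m * B)).trace +
        (k + 1) * sumSqSkewSYT (m + k) m := by
  have h := Matrix.transpose_mul_eq_of_differential coverMatrix (fun n => skewMatrix n m) B
    (skewMatrix_self m) (fun n hn => skewMatrix_succ hn) hB coverMatrix_succ_transpose_mul k
  rw [sumSqSkewSYT_eq_trace, sumSqSkewSYT_eq_trace]
  nth_rewrite 1 [skewMatrix_succ (Nat.le_add_right m k)]
  rw [Matrix.transpose_mul, Matrix.mul_assoc, h, Matrix.mul_add, Matrix.trace_add,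
    Matrix.mul_smul, Matrix.trace_smul, smul_eq_mul]

theorem sumSqSkewSYT_zero_succ (k : ℕ) :
    sumSqSkewSYT (k + 1) 0 = (k + 1) * sumSqSkewSYT k 0 := by
  simpa using sumSqSkewSYT_add_succ coverMatrix_zero_transpose_mul k

open Matrix in
theorem sumSqSkewSYT_succ_succ (m k : ℕ) :
    sumSqSkewSYT (m + 1 + k + 1) (m + 1) =
      sumSqSkewSYT (m + 1 + k) m + (k + 1) * sumSqSkewSYT (m + 1 + k) (m + 1) := by
  rw [sumSqSkewSYT_add_succ (coverMatrix_succ_transpose_mul m) k,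
    sumSqSkewSYT_eq_trace (m + 1 + k) m, ← Matrix.mul_assoc (skewMatrix _ _),
    skewMatrix_succ_right (by omega), ← Matrix.mul_assoc, Matrix.trace_mul_comm,
    ← Matrix.mul_assoc, ← Matrix.transpose_mul, skewMatrix_succ_right (by omega)]

theorem factorial_le_sumSqSkewSYT_mul (m k : ℕ) :
    (m + k).factorial ≤ sumSqSkewSYT (m + k) m * m.factorial := by
  induction k generalizing m with
  | zero =>
    rw [add_zero, sumSqSkewSYT_self]
    exact Nat.le_mul_of_pos_left _ Fintype.card_pos
  | succ k ih =>
    induction m with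
    | zero =>
      have h := ih 0
      rw [zero_add] at h ⊢
      rw [sumSqSkewSYT_zero_succ, Nat.factorial_succ, mul_assoc]
      exact Nat.mul_le_mul_left _ h
    | succ m ihm =>
      have h := ih (m + 1)
      rw [show m + (k + 1) = m + 1 + k by omega] at ihm
      rw [← add_assoc, sumSqSkewSYT_succ_succ, Nat.factorial_succ (m + 1 + k)]
      calc (m + 1 + k + 1) * (m + 1 + k).factorial
          = (m + 1) * (m + 1 + k).factorial + (k + 1) * (m + 1 + k).factorial := by ring
        _ ≤ (m + 1) * (sumSqSkewSYT (m + 1 + k) m * m.factorial) +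
            (k + 1) * (sumSqSkewSYT (m + 1 + k) (m + 1) * (m + 1).factorial) :=
          Nat.add_le_add (Nat.mul_le_mul_left _ ihm) (Nat.mul_le_mul_left _ h)
        _ = _ := by rw [Nat.factorial_succ]; ring

theorem sumSqSkewSYT_mul_le (m k : ℕ) :
    sumSqSkewSYT (m + k) m * m.factorial ≤
      (m + k).factorial * Fintype.card (Nat.Partition m) := by
  induction k generalizing m with
  | zero => rw [add_zero, sumSqSkewSYT_self, mul_comm]
  | succ k ih =>
    induction m with
    | zero =>
      have h := ih 0
      rw [zero_add] at h ⊢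
      rw [sumSqSkewSYT_zero_succ, Nat.factorial_succ, mul_assoc, mul_assoc]
      exact Nat.mul_le_mul_left _ h
    | succ m ihm =>
      have h := ih (m + 1)
      rw [show m + (k + 1) = m + 1 + k by omega] at ihm
      replace ihm := ihm.trans (Nat.mul_le_mul_left _ (Nat.Partition.card_le_card_succ m))
      rw [← add_assoc, sumSqSkewSYT_succ_succ, Nat.factorial_succ (m + 1 + k)]
      calc (sumSqSkewSYT (m + 1 + k) m + (k + 1) * sumSqSkewSYT (m + 1 + k) (m + 1)) *
            (m + 1).factorial
          = (m + 1) * (sumSqSkewSYT (m + 1 + k) m * m.factorial) +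
            (k + 1) * (sumSqSkewSYT (m + 1 + k) (m + 1) * (m + 1).factorial) := by
            rw [Nat.factorial_succ m]; ring
        _ ≤ (m + 1) * ((m + 1 + k).factorial * Fintype.card (Nat.Partition (m + 1))) +
            (k + 1) * ((m + 1 + k).factorial * Fintype.card (Nat.Partition (m + 1))) :=
          Nat.add_le_add (Nat.mul_le_mul_left _ ihm) (Nat.mul_le_mul_left _ h)
        _ = _ := by ring

theorem factorial_pred_mul_le {n m : ℕ} (h : m ≤ n) :
    (n - 1).factorial * m.factorial ≤ n.factorial * (m - 1).factorial := by
  cases m with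
  | zero => simpa using Nat.factorial_le (Nat.sub_le n 1)
  | succ m =>
    obtain ⟨n, rfl⟩ : ∃ k, n = k + 1 := ⟨n - 1, by omega⟩
    simp only [Nat.add_sub_cancel, Nat.factorial_succ]
    calc n.factorial * ((m + 1) * m.factorial) = (m + 1) * (n.factorial * m.factorial) := by ring
      _ ≤ (n + 1) * (n.factorial * m.factorial) := Nat.mul_le_mul_right _ h
      _ = _ := by ring

/-- For `0 ≤ m ≤ n`:
`(n-1)!/(m-1)! ≤ Σ_{λ⊢n, μ⊢m} (f^{λ/μ})² ≤ (n!/m!)·p(m)`. -/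
theorem stmt18 (n m : ℕ) (hm : m ≤ n) :
    ((n - 1).factorial : ℝ) / ((m - 1).factorial : ℝ) ≤
      ((∑ l : Nat.Partition n, ∑ mu : Nat.Partition m, (skewSYT l mu) ^ 2 : ℕ) : ℝ) ∧
    ((∑ l : Nat.Partition n, ∑ mu : Nat.Partition m, (skewSYT l mu) ^ 2 : ℕ) : ℝ) ≤
      ((n.factorial : ℝ) / (m.factorial : ℝ)) * (Fintype.card (Nat.Partition m) : ℝ) := by
  obtain ⟨k, rfl⟩ := Nat.exists_eq_add_of_le hm
  have hlow := factorial_le_sumSqSkewSYT_mul m k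
  have hup := sumSqSkewSYT_mul_le m k
  have hpred := factorial_pred_mul_le hm
  rw [← sumSqSkewSYT]
  have hpos : (0 : ℝ) < m.factorial := Nat.cast_pos.2 m.factorial_pos
  have hpos' : (0 : ℝ) < (m - 1).factorial := Nat.cast_pos.2 (m - 1).factorial_pos
  constructor
  · calc ((m + k - 1).factorial : ℝ) / ((m - 1).factorial : ℝ)
        ≤ ((m + k).factorial : ℝ) / (m.factorial : ℝ) := by
          rw [div_le_div_iff₀ hpos' hpos]
          exact_mod_cast hpred
      _ ≤ _ := by
          rw [div_le_iff₀ hpos]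
          exact_mod_cast hlow
  · rw [div_mul_eq_mul_div, le_div_iff₀ hpos]
    exact_mod_cast hup
end
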